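/- Let ν > 0, C_P > 0, and L_g ≥ 0 with L_g ≤ √(ν/(2·C_P²)). Let u, w : ℝ² → ℝ² be smooth (C^∞) compactly supported vector fields and set z := u − w. Assume the Poincaré inequality ‖z‖_{L²} ≤ C_P · ‖∇z‖_{L²} holds, and let G ≥ 0 be a real number satisfying G ≤ L_g · ‖z‖_{L²}. Then ν · ‖∇z‖_{L²}² + b̂(u, u, z) − b̂(w, w, z) + (27/(2ν³)) · ‖w‖_{L⁴}⁴ · ‖z‖_{L²}² − G² ≥ 0. -/

import Mathlib

open MeasureTheory

/-- Partial derivative `∂_j f` of a scalar function on `ℝ²`. -/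
noncomputable def pderiv2 (j : Fin 2) (f : (Fin 2 → ℝ) → ℝ) (x : Fin 2 → ℝ) : ℝ :=
  fderiv ℝ f x (Pi.single j 1)

/-- The trilinear form
`b̂(u,v,w) = ∫ ((u·∇)v)·w + (1/2) ∫ (div u)(v·w)` on `ℝ²`. -/
noncomputable def bhat (u v w : (Fin 2 → ℝ) → (Fin 2 → ℝ)) : ℝ :=
  (∫ x : Fin 2 → ℝ,
      ∑ i : Fin 2, (∑ j : Fin 2, u x j * pderiv2 j (fun y => v y i) x) * w x i) +
  (1 / 2) * ∫ x : Fin 2 → ℝ,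
      (∑ j : Fin 2, pderiv2 j (fun y => u y j) x) * (∑ i : Fin 2, v x i * w x i)

/-- The squared `L²`-norm of a vector field on `ℝ²`. -/
noncomputable def l2normSq (u : (Fin 2 → ℝ) → (Fin 2 → ℝ)) : ℝ :=
  ∫ x : Fin 2 → ℝ, ∑ i : Fin 2, (u x i) ^ 2

/-- The squared `L²`-norm of the gradient of a vector field on `ℝ²`. -/
noncomputable def gradL2normSq (u : (Fin 2 → ℝ) → (Fin 2 → ℝ)) : ℝ :=
  ∑ i : Fin 2, ∑ j : Fin 2, ∫ x : Fin 2 → ℝ, (pderiv2 j (fun y => u y i) x) ^ 2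

/-- The fourth power of the `L⁴`-norm of a vector field on `ℝ²`. -/
noncomputable def l4normP4 (u : (Fin 2 → ℝ) → (Fin 2 → ℝ)) : ℝ :=
  ∫ x : Fin 2 → ℝ, (∑ i : Fin 2, (u x i) ^ 2) ^ 2

theorem abs_le_integral_abs_deriv {f : ℝ → ℝ} (hf : ContDiff ℝ 1 f) (hfs : HasCompactSupport f)
    (x : ℝ) : |f x| ≤ ∫ t, |deriv f t| := by
  have hi : Integrable (deriv f) :=
    (hf.continuous_deriv le_rfl).integrable_of_hasCompactSupport hfs.deriv
  rw [← HasCompactSupport.integral_Iic_deriv_eq hf hfs x]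
  exact (abs_integral_le_integral_abs).trans
    (setIntegral_le_integral hi.abs (Filter.Eventually.of_forall fun t => abs_nonneg _))

theorem abs_le_integral_abs_pderiv2 {f : (Fin 2 → ℝ) → ℝ} (hf : ContDiff ℝ 1 f)
    (hfs : HasCompactSupport f) (j : Fin 2) (x : Fin 2 → ℝ) :
    |f x| ≤ ∫ t : ℝ, |pderiv2 j f (Function.update x j t)| := by
  have hg : ContDiff ℝ 1 (f ∘ Function.update x j) := hf.comp (contDiff_update 1 x j)
  have hgs : HasCompactSupport (f ∘ Function.update x j) :=
    hfs.comp_isClosedEmbedding (isClosedEmbedding_update x j)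
  have hd : ∀ t, deriv (f ∘ Function.update x j) t = pderiv2 j f (Function.update x j t) := by
    intro t
    exact ((hf.differentiable one_ne_zero _).hasFDerivAt.comp_hasDerivAt t
      (hasDerivAt_update x j t)).deriv
  simpa [hd] using abs_le_integral_abs_deriv hg hgs (x j)

theorem continuous_pderiv2 {f : (Fin 2 → ℝ) → ℝ} (hf : ContDiff ℝ 1 f) (j : Fin 2) :
    Continuous (pderiv2 j f) :=
  (hf.continuous_fderiv one_ne_zero).clm_apply continuous_const

theorem pderiv2_eq_zero {f : (Fin 2 → ℝ) → ℝ} {x : Fin 2 → ℝ} (hx : x ∉ tsupport f)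
    (j : Fin 2) : pderiv2 j f x = 0 := by
  simp [pderiv2, fderiv_of_notMem_tsupport (𝕜 := ℝ) hx]

theorem hasCompactSupport_pderiv2 {f : (Fin 2 → ℝ) → ℝ} (hf : HasCompactSupport f)
    (j : Fin 2) : HasCompactSupport (pderiv2 j f) :=
  HasCompactSupport.intro hf fun _ hx => pderiv2_eq_zero hx j

theorem integral_pderiv2_eq_zero {f : (Fin 2 → ℝ) → ℝ} (hf : ContDiff ℝ 1 f)
    (hfs : HasCompactSupport f) (j : Fin 2) : ∫ x, pderiv2 j f x = 0 := by
  have hi : Integrable f := hf.continuous.integrable_of_hasCompactSupport hfs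
  have hi' : Integrable fun x => fderiv ℝ f x (Pi.single j 1) :=
    (continuous_pderiv2 hf j).integrable_of_hasCompactSupport (hasCompactSupport_pderiv2 hfs j)
  have h := integral_mul_fderiv_eq_neg_fderiv_mul_of_integrable
    (μ := (volume : Measure (Fin 2 → ℝ))) (f := fun _ => (1 : ℝ)) (g := f) (v := Pi.single j 1)
    (by simp) (by simpa using hi') (by simpa using hi)
    (fun x _ => differentiableAt_const _) (fun x _ => hf.differentiable one_ne_zero x)
  simpa [pderiv2] using h

theorem integral_sq_le_mul_of_le_slice_integrals {F g₁ g₂ : ℝ × ℝ → ℝ}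
    (h₁ : Integrable g₁) (h₂ : Integrable g₂)
    (hF₁ : ∀ p : ℝ × ℝ, |F p| ≤ ∫ s, g₁ (s, p.2)) (hF₂ : ∀ p : ℝ × ℝ, |F p| ≤ ∫ s, g₂ (p.1, s)) :
    ∫ p, F p ^ 2 ≤ (∫ p, g₁ p) * ∫ p, g₂ p := by
  rw [Measure.volume_eq_prod] at *
  rw [integral_prod_symm g₁ h₁, integral_prod g₂ h₂, mul_comm, ← integral_prod_mul]
  refine integral_mono_of_nonneg (Filter.Eventually.of_forall fun p => sq_nonneg _)
    (h₂.integral_prod_left.mul_prod h₁.integral_prod_right)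
    (Filter.Eventually.of_forall fun p => ?_)
  have := mul_le_mul (hF₂ p) (hF₁ p) (abs_nonneg _) ((abs_nonneg _).trans (hF₂ p))
  simpa [← sq] using this

theorem integral_sq_le_integral_abs_pderiv2_mul {f : (Fin 2 → ℝ) → ℝ} (hf : ContDiff ℝ 1 f)
    (hfs : HasCompactSupport f) :
    ∫ x, f x ^ 2 ≤ (∫ x, |pderiv2 0 f x|) * ∫ x, |pderiv2 1 f x| := by
  have hmp := (volume_preserving_finTwoArrow ℝ).symm
  have hi : ∀ j, Integrable fun p => |pderiv2 j f (MeasurableEquiv.finTwoArrow.symm p)| := fun j =>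
    (hmp.integrable_comp_emb (MeasurableEquiv.measurableEmbedding _)).2
      ((continuous_pderiv2 hf j).integrable_of_hasCompactSupport
        (hasCompactSupport_pderiv2 hfs j)).abs
  rw [← hmp.integral_comp', ← hmp.integral_comp', ← hmp.integral_comp']
  refine integral_sq_le_mul_of_le_slice_integrals
    (F := fun p => f (MeasurableEquiv.finTwoArrow.symm p)) (hi 0) (hi 1) (fun p => ?_) (fun p => ?_)
  · convert abs_le_integral_abs_pderiv2 hf hfs 0 (MeasurableEquiv.finTwoArrow.symm p) using 5 with s
    ext i; fin_cases i <;> simp [MeasurableEquiv.finTwoArrow]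
  · convert abs_le_integral_abs_pderiv2 hf hfs 1 (MeasurableEquiv.finTwoArrow.symm p) using 5 with s
    ext i; fin_cases i <;> simp [MeasurableEquiv.finTwoArrow]

theorem sq_integral_le_mul_integral {α : Type*} [MeasurableSpace α] {μ : Measure α}
    {a b h : α → ℝ} (ha : Integrable a μ) (hb : Integrable b μ) (hh : Integrable h μ)
    (ha0 : ∀ x, 0 ≤ a x) (hb0 : ∀ x, 0 ≤ b x) (hab : ∀ x, h x ^ 2 ≤ a x * b x) :
    (∫ x, h x ∂μ) ^ 2 ≤ (∫ x, a x ∂μ) * ∫ x, b x ∂μ := by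
  have key : ∀ t : ℝ, 0 ≤ (∫ x, a x ∂μ) * (t * t) + (2 * ∫ x, h x ∂μ) * t + ∫ x, b x ∂μ := by
    intro t
    have hsum : (∫ x, a x ∂μ) * (t * t) + (2 * ∫ x, h x ∂μ) * t + ∫ x, b x ∂μ
        = ∫ x, a x * (t * t) + h x * (2 * t) + b x ∂μ := by
      have hah : Integrable (fun x => a x * (t * t) + h x * (2 * t)) μ :=
        (ha.mul_const _).add (hh.mul_const _)
      rw [integral_add hah hb, integral_add (ha.mul_const _) (hh.mul_const _),
        integral_mul_const, integral_mul_const]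
      ring
    rw [hsum]
    refine integral_nonneg fun x => ?_
    have h1 := ha0 x
    have h2 := hb0 x
    have h3 := hab x
    show 0 ≤ a x * (t * t) + h x * (2 * t) + b x
    rcases h1.eq_or_lt with h0 | h0
    · have : h x = 0 := by
        rw [← h0, zero_mul] at h3
        exact pow_eq_zero_iff two_ne_zero |>.1 (le_antisymm h3 (sq_nonneg _))
      rw [← h0, this]; linarith
    · refine nonneg_of_mul_nonneg_right (a := a x) ?_ h0
      nlinarith [sq_nonneg (a x * t + h x)]
  have := discrim_le_zero key
  rw [discrim] at this
  linarith

theorem ContDiff.component {u : (Fin 2 → ℝ) → (Fin 2 → ℝ)} (hu : ContDiff ℝ 1 u) (i : Fin 2) :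
    ContDiff ℝ 1 fun x => u x i :=
  contDiff_pi.1 hu i

theorem continuous_pderiv2_component {u : (Fin 2 → ℝ) → (Fin 2 → ℝ)} (hu : ContDiff ℝ 1 u)
    (i j : Fin 2) : Continuous fun x => pderiv2 j (fun y => u y i) x :=
  continuous_pderiv2 (hu.component i) j

theorem apply_eq_zero_of_notMem_tsupport {u : (Fin 2 → ℝ) → (Fin 2 → ℝ)} {x : Fin 2 → ℝ}
    (hx : x ∉ tsupport u) (i : Fin 2) : u x i = 0 := by
  simp [image_eq_zero_of_notMem_tsupport hx]

theorem pderiv2_component_eq_zero {u : (Fin 2 → ℝ) → (Fin 2 → ℝ)} {x : Fin 2 → ℝ}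
    (hx : x ∉ tsupport u) (i j : Fin 2) : pderiv2 j (fun y => u y i) x = 0 :=
  pderiv2_eq_zero (fun h => hx (tsupport_comp_subset (g := fun v : Fin 2 → ℝ => v i) rfl u h)) j

theorem integrable_of_eq_zero_off_tsupport {u : (Fin 2 → ℝ) → (Fin 2 → ℝ)}
    (hus : HasCompactSupport u) {f : (Fin 2 → ℝ) → ℝ} (hf : Continuous f)
    (h : ∀ x, x ∉ tsupport u → f x = 0) : Integrable f :=
  hf.integrable_of_hasCompactSupport (HasCompactSupport.intro hus h)

theorem pderiv2_add {f g : (Fin 2 → ℝ) → ℝ} {x : Fin 2 → ℝ} (hf : DifferentiableAt ℝ f x)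
    (hg : DifferentiableAt ℝ g x) (j : Fin 2) :
    pderiv2 j (fun y => f y + g y) x = pderiv2 j f x + pderiv2 j g x := by
  simp [pderiv2, fderiv_fun_add hf hg]

theorem pderiv2_sub {f g : (Fin 2 → ℝ) → ℝ} {x : Fin 2 → ℝ} (hf : DifferentiableAt ℝ f x)
    (hg : DifferentiableAt ℝ g x) (j : Fin 2) :
    pderiv2 j (fun y => f y - g y) x = pderiv2 j f x - pderiv2 j g x := by
  simp [pderiv2, fderiv_fun_sub hf hg]

theorem pderiv2_mul {f g : (Fin 2 → ℝ) → ℝ} {x : Fin 2 → ℝ} (hf : DifferentiableAt ℝ f x)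
    (hg : DifferentiableAt ℝ g x) (j : Fin 2) :
    pderiv2 j (fun y => f y * g y) x = f x * pderiv2 j g x + pderiv2 j f x * g x := by
  simp [pderiv2, fderiv_fun_mul hf hg, mul_comm (g x)]

/-- The pointwise integrand of `bhat`. -/
noncomputable def bhatDensity (u v w : (Fin 2 → ℝ) → (Fin 2 → ℝ)) (x : Fin 2 → ℝ) : ℝ :=
  (∑ i : Fin 2, (∑ j : Fin 2, u x j * pderiv2 j (fun y => v y i) x) * w x i) +
    (1 / 2) * ((∑ j : Fin 2, pderiv2 j (fun y => u y j) x) * (∑ i : Fin 2, v x i * w x i))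

section

variable {u v w z : (Fin 2 → ℝ) → (Fin 2 → ℝ)}

theorem integrable_bhatDensity (hu : ContDiff ℝ 1 u) (hv : ContDiff ℝ 1 v) (hw : ContDiff ℝ 1 w)
    (hus : HasCompactSupport u) : Integrable (bhatDensity u v w) := by
  have hv' := continuous_pderiv2_component hv
  have hu' := continuous_pderiv2_component hu
  have := hu.continuous
  have := hv.continuous
  have := hw.continuous
  refine integrable_of_eq_zero_off_tsupport hus (by unfold bhatDensity; fun_prop) fun x hx => ?_
  simp [bhatDensity, apply_eq_zero_of_notMem_tsupport hx, pderiv2_component_eq_zero hx]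

theorem bhat_eq_integral_bhatDensity (hu : ContDiff ℝ 1 u) (hv : ContDiff ℝ 1 v)
    (hw : ContDiff ℝ 1 w) (hus : HasCompactSupport u) :
    bhat u v w = ∫ x, bhatDensity u v w x := by
  have hv' := continuous_pderiv2_component hv
  have hu' := continuous_pderiv2_component hu
  have := hu.continuous
  have := hv.continuous
  have := hw.continuous
  unfold bhat bhatDensity
  rw [integral_add, integral_const_mul]
  · refine integrable_of_eq_zero_off_tsupport hus (by fun_prop) fun x hx => ?_
    simp [apply_eq_zero_of_notMem_tsupport hx]
  · refine integrable_of_eq_zero_off_tsupport hus (by fun_prop) fun x hx => ?_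
    simp [pderiv2_component_eq_zero hx]

theorem bhat_add_bhat_swap (hu : ContDiff ℝ 1 u) (hv : ContDiff ℝ 1 v) (hw : ContDiff ℝ 1 w)
    (hus : HasCompactSupport u) : bhat u v w + bhat u w v = 0 := by
  have hF : ∀ j, ContDiff ℝ 1 fun x => u x j * (v x 0 * w x 0 + v x 1 * w x 1) := fun j =>
    (hu.component j).mul (((hv.component 0).mul (hw.component 0)).add
      ((hv.component 1).mul (hw.component 1)))
  have hFs : ∀ j, HasCompactSupport fun x => u x j * (v x 0 * w x 0 + v x 1 * w x 1) := fun j =>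
    HasCompactSupport.intro hus fun x hx => by simp [apply_eq_zero_of_notMem_tsupport hx]
  rw [bhat_eq_integral_bhatDensity hu hv hw hus, bhat_eq_integral_bhatDensity hu hw hv hus,
    ← integral_add (integrable_bhatDensity hu hv hw hus) (integrable_bhatDensity hu hw hv hus)]
  calc ∫ x, bhatDensity u v w x + bhatDensity u w v x
      = ∫ x, pderiv2 0 (fun x => u x 0 * (v x 0 * w x 0 + v x 1 * w x 1)) x +
          pderiv2 1 (fun x => u x 1 * (v x 0 * w x 0 + v x 1 * w x 1)) x := by
        refine integral_congr_ae (Filter.Eventually.of_forall fun x => ?_)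
        have du := fun i => (hu.component i).differentiable one_ne_zero x
        have dv := fun i => (hv.component i).differentiable one_ne_zero x
        have dw := fun i => (hw.component i).differentiable one_ne_zero x
        have d : ∀ j, pderiv2 j (fun x => u x j * (v x 0 * w x 0 + v x 1 * w x 1)) x = _ :=
          fun j => pderiv2_mul (du j) (((dv 0).fun_mul (dw 0)).fun_add ((dv 1).fun_mul (dw 1))) j
        have d' : ∀ j, pderiv2 j (fun x => v x 0 * w x 0 + v x 1 * w x 1) x = _ :=
          fun j => pderiv2_add ((dv 0).fun_mul (dw 0)) ((dv 1).fun_mul (dw 1)) j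
        have d'' : ∀ i j, pderiv2 j (fun x => v x i * w x i) x = _ :=
          fun i j => pderiv2_mul (dv i) (dw i) j
        simp only [bhatDensity, Fin.sum_univ_two, d, d', d'']
        ring
    _ = 0 := by
        have hi := fun j => (continuous_pderiv2 (hF j) j).integrable_of_hasCompactSupport
          (μ := volume) (hasCompactSupport_pderiv2 (hFs j) j)
        rw [integral_add (hi 0) (hi 1), integral_pderiv2_eq_zero (hF 0) (hFs 0),
          integral_pderiv2_eq_zero (hF 1) (hFs 1), add_zero]

theorem bhat_sub_bhat_eq_neg (hu : ContDiff ℝ 1 u) (hw : ContDiff ℝ 1 w)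
    (hus : HasCompactSupport u) (hws : HasCompactSupport w) :
    bhat u u (u - w) - bhat w w (u - w) = -bhat (u - w) (u - w) w := by
  have hz : ContDiff ℝ 1 (u - w) := hu.sub hw
  have hzs : HasCompactSupport (u - w) := hus.sub hws
  have h₁ := bhat_add_bhat_swap hu hz hz hus
  have h₂ := bhat_add_bhat_swap hz hw hz hzs
  have h₃ : bhat u u (u - w) - bhat w w (u - w)
      = bhat u (u - w) (u - w) + bhat (u - w) w (u - w) := by
    rw [bhat_eq_integral_bhatDensity hu hu hz hus, bhat_eq_integral_bhatDensity hw hw hz hws,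
      bhat_eq_integral_bhatDensity hu hz hz hus, bhat_eq_integral_bhatDensity hz hw hz hzs,
      ← integral_sub (integrable_bhatDensity hu hu hz hus) (integrable_bhatDensity hw hw hz hws),
      ← integral_add (integrable_bhatDensity hu hz hz hus) (integrable_bhatDensity hz hw hz hzs)]
    refine integral_congr_ae (Filter.Eventually.of_forall fun x => ?_)
    have d : ∀ i j, pderiv2 j (fun x => u x i - w x i) x = _ := fun i j =>
      pderiv2_sub ((hu.component i).differentiable one_ne_zero x)
        ((hw.component i).differentiable one_ne_zero x) j
    simp only [bhatDensity, Fin.sum_univ_two, Pi.sub_apply, d]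
    ring
  linarith

theorem gradL2normSq_eq_integral (hz : ContDiff ℝ 1 z) (hzs : HasCompactSupport z) :
    gradL2normSq z = ∫ x, ∑ i : Fin 2, ∑ j : Fin 2, (pderiv2 j (fun y => z y i) x) ^ 2 := by
  have hz' := continuous_pderiv2_component hz
  have hi : ∀ i j, Integrable fun x => (pderiv2 j (fun y => z y i) x) ^ 2 := fun i j =>
    integrable_of_eq_zero_off_tsupport hzs (by fun_prop) fun x hx => by
      simp [pderiv2_component_eq_zero hx]
  rw [integral_finsetSum _ fun i _ => integrable_finsetSum _ fun j _ => hi i j]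
  exact Finset.sum_congr rfl fun i _ => (integral_finsetSum _ fun j _ => hi i j).symm

/-- Ladyzhenskaya's inequality in the plane. -/
theorem l4normP4_le (hz : ContDiff ℝ 1 z) (hzs : HasCompactSupport z) :
    l4normP4 z ≤ 2 * l2normSq z * gradL2normSq z := by
  have hz' := continuous_pderiv2_component hz
  have hzc := hz.continuous
  have hf : ContDiff ℝ 1 fun x => ∑ i : Fin 2, (z x i) ^ 2 :=
    ContDiff.sum fun i _ => (hz.component i).pow 2
  have hfs : HasCompactSupport fun x => ∑ i : Fin 2, (z x i) ^ 2 :=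
    HasCompactSupport.intro hzs fun x hx => by simp [apply_eq_zero_of_notMem_tsupport hx]
  have hp : ∀ j x, pderiv2 j (fun x => ∑ i : Fin 2, (z x i) ^ 2) x =
      2 * (z x 0 * pderiv2 j (fun y => z y 0) x + z x 1 * pderiv2 j (fun y => z y 1) x) := by
    intro j x
    have dz := fun i => (hz.component i).differentiable one_ne_zero x
    have d : pderiv2 j (fun x => z x 0 * z x 0 + z x 1 * z x 1) x =
        pderiv2 j (fun x => z x 0 * z x 0) x + pderiv2 j (fun x => z x 1 * z x 1) x :=
      pderiv2_add ((dz 0).mul (dz 0)) ((dz 1).mul (dz 1)) j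
    have d' : ∀ i, pderiv2 j (fun x => z x i * z x i) x = _ := fun i => pderiv2_mul (dz i) (dz i) j
    simp only [Fin.sum_univ_two, sq]
    rw [d, d' 0, d' 1]
    ring
  have hi : ∀ j, Integrable fun x => 4 * ∑ i : Fin 2, (pderiv2 j (fun y => z y i) x) ^ 2 :=
    fun j => integrable_of_eq_zero_off_tsupport hzs (by fun_prop) fun x hx => by
      simp [pderiv2_component_eq_zero hx]
  have hD : ∀ j, (∫ x, |pderiv2 j (fun x => ∑ i : Fin 2, (z x i) ^ 2) x|) ^ 2 ≤
      l2normSq z * ∫ x, 4 * ∑ i : Fin 2, (pderiv2 j (fun y => z y i) x) ^ 2 := by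
    intro j
    refine sq_integral_le_mul_integral (hf.continuous.integrable_of_hasCompactSupport hfs) (hi j)
      ((continuous_pderiv2 hf j).integrable_of_hasCompactSupport
        (hasCompactSupport_pderiv2 hfs j)).abs
      (fun x => by positivity) (fun x => by positivity) fun x => ?_
    rw [sq_abs, hp]
    simp only [Fin.sum_univ_two]
    nlinarith [sq_nonneg (z x 0 * pderiv2 j (fun y => z y 1) x -
      z x 1 * pderiv2 j (fun y => z y 0) x)]
  have hD0 : ∀ j, 0 ≤ ∫ x, 4 * ∑ i : Fin 2, (pderiv2 j (fun y => z y i) x) ^ 2 := fun j =>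
    integral_nonneg fun x => by positivity
  have hsum : (∫ x, 4 * ∑ i : Fin 2, (pderiv2 0 (fun y => z y i) x) ^ 2) +
      ∫ x, 4 * ∑ i : Fin 2, (pderiv2 1 (fun y => z y i) x) ^ 2 = 4 * gradL2normSq z := by
    rw [gradL2normSq_eq_integral hz hzs, ← integral_add (hi 0) (hi 1),
      ← integral_const_mul]
    congr 1
    ext x
    simp only [Fin.sum_univ_two]
    ring
  have hZ : 0 ≤ l2normSq z := integral_nonneg fun x => by positivity
  have hX : 0 ≤ gradL2normSq z := by linarith [hD0 0, hD0 1]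
  have hQ := integral_sq_le_integral_abs_pderiv2_mul hf hfs
  change l4normP4 z ≤ _ at hQ
  refine hQ.trans (abs_le_of_sq_le_sq' ?_ (by positivity)).2
  rw [mul_pow]
  refine (mul_le_mul (hD 0) (hD 1) (sq_nonneg _) (mul_nonneg hZ (hD0 0))).trans ?_
  have := four_mul_le_sq_add (∫ x, 4 * ∑ i : Fin 2, (pderiv2 0 (fun y => z y i) x) ^ 2)
    (∫ x, 4 * ∑ i : Fin 2, (pderiv2 1 (fun y => z y i) x) ^ 2)
  rw [hsum] at this
  nlinarith [mul_le_mul_of_nonneg_left this (sq_nonneg (l2normSq z))]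

theorem sq_bhatDensity_le (x : Fin 2 → ℝ) :
    bhatDensity z z w x ^ 2 ≤ ((∑ i : Fin 2, (z x i) ^ 2) * ∑ i : Fin 2, (w x i) ^ 2) *
      (5 / 2 * ∑ i : Fin 2, ∑ j : Fin 2, (pderiv2 j (fun y => z y i) x) ^ 2) := by
  simp only [bhatDensity, Fin.sum_univ_two]
  generalize pderiv2 0 (fun y => z y 0) x = a
  generalize pderiv2 1 (fun y => z y 0) x = b
  generalize pderiv2 0 (fun y => z y 1) x = c
  generalize pderiv2 1 (fun y => z y 1) x = d
  generalize z x 0 = p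
  generalize z x 1 = q
  generalize w x 0 = r
  generalize w x 1 = s
  have cs : ∀ α β γ δ : ℝ, (α * a + β * b + γ * c + δ * d) ^ 2 ≤
      (α ^ 2 + β ^ 2 + γ ^ 2 + δ ^ 2) * (a ^ 2 + b ^ 2 + c ^ 2 + d ^ 2) := by
    intro α β γ δ
    linarith [sq_nonneg (α * b - β * a), sq_nonneg (α * c - γ * a), sq_nonneg (α * d - δ * a),
      sq_nonneg (β * c - γ * b), sq_nonneg (β * d - δ * b), sq_nonneg (γ * d - δ * c)]
  have h := cs (p * r + 1 / 2 * (p * r + q * s)) (q * r) (p * s)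
    (q * s + 1 / 2 * (p * r + q * s))
  have hc : (p * r + 1 / 2 * (p * r + q * s)) ^ 2 + (q * r) ^ 2 + (p * s) ^ 2 +
      (q * s + 1 / 2 * (p * r + q * s)) ^ 2 ≤ 5 / 2 * ((p ^ 2 + q ^ 2) * (r ^ 2 + s ^ 2)) := by
    linarith [sq_nonneg (p * s - q * r)]
  have h' := h.trans (mul_le_mul_of_nonneg_right hc (by positivity))
  refine le_of_eq_of_le ?_ (h'.trans_eq ?_) <;> ring

theorem bhat_pow_four_le (hz : ContDiff ℝ 1 z) (hw : ContDiff ℝ 1 w)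
    (hzs : HasCompactSupport z) (hws : HasCompactSupport w) :
    bhat z z w ^ 4 ≤ 16 * gradL2normSq z ^ 3 * (l4normP4 w * l2normSq z) := by
  have hz' := continuous_pderiv2_component hz
  have hzc := hz.continuous
  have hwc := hw.continuous
  set S := ∫ x, (∑ i : Fin 2, (z x i) ^ 2) * ∑ i : Fin 2, (w x i) ^ 2
  have hQ := l4normP4_le hz hzs
  have hS0 : 0 ≤ S := integral_nonneg fun x => by positivity
  have hW : 0 ≤ l4normP4 w := integral_nonneg fun x => by positivity
  have hZ : 0 ≤ l2normSq z := integral_nonneg fun x => by positivity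
  have hX : 0 ≤ gradL2normSq z := by
    rw [gradL2normSq_eq_integral hz hzs]
    exact integral_nonneg fun x => by positivity
  have hSi : Integrable fun x => (∑ i : Fin 2, (z x i) ^ 2) * ∑ i : Fin 2, (w x i) ^ 2 :=
    integrable_of_eq_zero_off_tsupport hzs (by fun_prop) fun x hx => by
      simp [apply_eq_zero_of_notMem_tsupport hx]
  have hS : S ^ 2 ≤ l4normP4 z * l4normP4 w := by
    refine sq_integral_le_mul_integral ?_ ?_ hSi (fun x => by positivity)
      (fun x => by positivity) fun x => (mul_pow _ _ 2).le
    · exact integrable_of_eq_zero_off_tsupport hzs (by fun_prop) fun x hx => by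
        simp [apply_eq_zero_of_notMem_tsupport hx]
    · exact integrable_of_eq_zero_off_tsupport hws (by fun_prop) fun x hx => by
        simp [apply_eq_zero_of_notMem_tsupport hx]
  have hb : bhat z z w ^ 2 ≤ S * (5 / 2 * gradL2normSq z) := by
    rw [bhat_eq_integral_bhatDensity hz hz hw hzs, gradL2normSq_eq_integral hz hzs,
      ← integral_const_mul]
    refine sq_integral_le_mul_integral hSi ?_ (integrable_bhatDensity hz hz hw hzs)
      (fun x => by positivity) (fun x => by positivity) sq_bhatDensity_le
    exact integrable_of_eq_zero_off_tsupport hzs (by fun_prop) fun x hx => by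
      simp [pderiv2_component_eq_zero hx]
  calc bhat z z w ^ 4 = (bhat z z w ^ 2) ^ 2 := by ring
    _ ≤ (S * (5 / 2 * gradL2normSq z)) ^ 2 := by gcongr
    _ = 25 / 4 * gradL2normSq z ^ 2 * S ^ 2 := by ring
    _ ≤ 25 / 4 * gradL2normSq z ^ 2 *
        ((2 * l2normSq z * gradL2normSq z) * l4normP4 w) := by
      gcongr
      exact hS.trans (mul_le_mul_of_nonneg_right hQ hW)
    _ = 25 / 2 * gradL2normSq z ^ 3 * (l4normP4 w * l2normSq z) := by ring
    _ ≤ 16 * gradL2normSq z ^ 3 * (l4normP4 w * l2normSq z) := by gcongr; norm_num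

end

theorem le_of_pow_four_le {ν X Y b : ℝ} (hν : 0 < ν) (hX : 0 ≤ X) (hY : 0 ≤ Y)
    (hb : b ^ 4 ≤ 16 * X ^ 3 * Y) : b ≤ ν / 2 * X + 27 / (2 * ν ^ 3) * Y := by
  have amgm : ∀ a d : ℝ, 0 ≤ a → 0 ≤ d → 256 * (a ^ 3 * d) ≤ (3 * a + d) ^ 4 := by
    intro a d ha hd
    have : 0 ≤ (a - d) ^ 2 * (81 * a ^ 2 + 14 * (a * d) + d ^ 2) := by positivity
    linarith
  have h := amgm (ν / 6 * X) (27 / (2 * ν ^ 3) * Y) (by positivity) (by positivity)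
  have he : 256 * ((ν / 6 * X) ^ 3 * (27 / (2 * ν ^ 3) * Y)) = 16 * X ^ 3 * Y := by
    field_simp
    ring
  have hs : 3 * (ν / 6 * X) + 27 / (2 * ν ^ 3) * Y = ν / 2 * X + 27 / (2 * ν ^ 3) * Y := by ring
  rw [he, hs] at h
  exact le_of_pow_le_pow_left₀ four_ne_zero (by positivity) (hb.trans h)

/-- Lemma 4.4 (local monotonicity including the noise term): with `z = u − w`,
the Poincaré inequality `‖z‖_{L²} ≤ C_P‖∇z‖_{L²}`, and `0 ≤ G ≤ L_g‖z‖_{L²}`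
where `L_g ≤ √(ν/(2C_P²))`, one has
`ν‖∇z‖² + b̂(u,u,z) − b̂(w,w,z) + (27/(2ν³))‖w‖_{L⁴}⁴‖z‖_{L²}² − G² ≥ 0`. -/
theorem local_monotonicity_noise (ν C_P L_g : ℝ) (hν : 0 < ν) (hCP : 0 < C_P)
    (hLg0 : 0 ≤ L_g) (hLg : L_g ≤ Real.sqrt (ν / (2 * C_P ^ 2)))
    (u w : (Fin 2 → ℝ) → (Fin 2 → ℝ))
    (hu : ContDiff ℝ (⊤ : ℕ∞) u) (hw : ContDiff ℝ (⊤ : ℕ∞) w)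
    (hus : HasCompactSupport u) (hws : HasCompactSupport w)
    (hPoincare : Real.sqrt (l2normSq (u - w)) ≤
      C_P * Real.sqrt (gradL2normSq (u - w)))
    (G : ℝ) (hG0 : 0 ≤ G)
    (hG : G ≤ L_g * Real.sqrt (l2normSq (u - w))) :
    0 ≤ ν * gradL2normSq (u - w) + bhat u u (u - w) - bhat w w (u - w) +
        (27 / (2 * ν ^ 3)) * l4normP4 w * l2normSq (u - w) - G ^ 2 := by

  have hu1 : ContDiff ℝ 1 u := hu.of_le (by norm_cast)
  have hw1 : ContDiff ℝ 1 w := hw.of_le (by norm_cast)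
  have hz1 : ContDiff ℝ 1 (u - w) := hu1.sub hw1
  have hzs : HasCompactSupport (u - w) := hus.sub hws
  have hX : 0 ≤ gradL2normSq (u - w) := by
    rw [gradL2normSq_eq_integral hz1 hzs]
    exact integral_nonneg fun x => by positivity
  have hZ : 0 ≤ l2normSq (u - w) := integral_nonneg fun x => by positivity
  have hW : 0 ≤ l4normP4 w := integral_nonneg fun x => by positivity
  have hb := le_of_pow_four_le hν hX (mul_nonneg hW hZ) (bhat_pow_four_le hz1 hw1 hzs hws)
  have hsub := bhat_sub_bhat_eq_neg hu1 hw1 hus hws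
  have hG2 : G ^ 2 ≤ ν / 2 * gradL2normSq (u - w) := by
    calc G ^ 2 ≤ (Real.sqrt (ν / (2 * C_P ^ 2)) * (C_P * Real.sqrt (gradL2normSq (u - w)))) ^ 2 := by
          gcongr
          exact hG.trans (mul_le_mul hLg hPoincare (Real.sqrt_nonneg _) (Real.sqrt_nonneg _))
      _ = ν / 2 * gradL2normSq (u - w) := by
          rw [mul_pow, mul_pow, Real.sq_sqrt (by positivity), Real.sq_sqrt hX]
          field_simp
  linarith
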